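/- Generating function for symmetric cylindric partitions (explicit product form): let m ≥ 2 and let δ=(δ_i)_{1≤i≤m−1} be a profile. Define the multisets W_4(δ) = {2m−1} ∪ {2i−1 : δ_i=−1} ∪ {2m−2i : δ_i=1} and W_5(δ) = {2i+2j−2 : i<j, δ_i=δ_j=−1} ∪ {4m−2i−2j : i<j, δ_i=δ_j=1} ∪ {2(2m−1)+2i−2j : i<j, δ_i<δ_j} ∪ {2j−2i : i<j, δ_i>δ_j} (indices ranging over 1≤i<j≤m−1). Then Σ_{ω ∈ SCP_δ} z^{|ω|} = ∏_{k≥0} (∏_{t∈W_4(δ)} (1−z^{(2m−1)k+t})^{−1}) (∏_{t∈W_5(δ)} (1−z^{2(2m−1)k+t})^{−1}), as an identity of formal power series in z. -/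

import Mathlib

open scoped BigOperators

/-- An integer partition: a weakly decreasing, finitely supported sequence of
nonnegative integers. -/
structure Ptn where
  toFun : ℕ →₀ ℕ
  antitone' : ∀ ⦃i j : ℕ⦄, i ≤ j → toFun j ≤ toFun i

namespace Ptn
/-- the `i`-th part (0-indexed) -/
def part (lam : Ptn) (i : ℕ) : ℕ := lam.toFun i
/-- the size `|λ|` -/
def size (lam : Ptn) : ℕ := lam.toFun.sum fun _ k => k
end Ptn

/-- `HStrip μ λ` means `μ ≺ λ`, i.e. `λ/μ` is a horizontal strip:
`λ_i ≥ μ_i ≥ λ_{i+1}` for all `i`. -/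
def HStrip (mu lam : Ptn) : Prop :=
  ∀ i : ℕ, mu.part i ≤ lam.part i ∧ lam.part (i + 1) ≤ mu.part i
/-- `δ` is a `±1`-profile on the indices `1, …, h` -/
def IsProfile (h : ℕ) (δ : ℕ → ℤ) : Prop := ∀ i, 1 ≤ i → i ≤ h → δ i = 1 ∨ δ i = -1

/-- A skew doubled shifted plane partition `ω = (λ^0, …, λ^{m-1})` with profile
`(δ_1, …, δ_{m-1})`: if `δ_{i+1} = 1` then `λ^i ≺ λ^{i+1}`, and if
`δ_{i+1} = -1` then `λ^i ≻ λ^{i+1}`. -/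
def IsDSPP (m : ℕ) (δ : ℕ → ℤ) (L : Fin m → Ptn) : Prop :=
  ∀ (i : ℕ) (hi : i + 1 < m),
    if δ (i + 1) = 1 then HStrip (L ⟨i, Nat.lt_of_succ_lt hi⟩) (L ⟨i + 1, hi⟩)
    else HStrip (L ⟨i + 1, hi⟩) (L ⟨i, Nat.lt_of_succ_lt hi⟩)
/-- the coefficientwise (product) topology on formal power series -/
instance : TopologicalSpace (PowerSeries ℚ) :=
  inferInstanceAs (TopologicalSpace ((Unit →₀ ℕ) → ℚ))

/-- the doubled profile `(-δ_h, …, -δ_1, δ_1, …, δ_h)` of the profile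
`δ = (δ_1, …, δ_h)` -/
def dblProfile (h : ℕ) (δ : ℕ → ℤ) : ℕ → ℤ :=
  fun j => if j ≤ h then -δ (h + 1 - j) else δ (j - h)

/-- A symmetric cylindric partition with profile `δ = (δ_1, …, δ_h)`: a skew
doubled shifted plane partition `ω = (λ^h, …, λ^1, λ^0, λ^1, …, λ^h)` (a
palindromic sequence of `2h+1` partitions) with the doubled profile
`(-δ_h, …, -δ_1, δ_1, …, δ_h)`. -/
def IsSCP (h : ℕ) (δ : ℕ → ℤ) (M : Fin (2 * h + 1) → Ptn) : Prop :=
  IsDSPP (2 * h + 1) (dblProfile h δ) M ∧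
    ∀ k : Fin (2 * h + 1), M k = M ⟨2 * h - (k : ℕ), by omega⟩

/-- the size `|ω| = |λ^0| + 2 Σ_{i=1}^h |λ^i|` of a symmetric cylindric
partition -/
noncomputable def scpSize (h : ℕ) (M : Fin (2 * h + 1) → Ptn) : ℕ :=
  (M ⟨h, by omega⟩).size +
    2 * ∑ i : Fin h, (M ⟨h + (i : ℕ) + 1, by have := i.isLt; omega⟩).size

/-- the multiset `W_4(δ) = {2m-1} ∪ {2i-1 : δ_i = -1} ∪ {2m-2i : δ_i = 1}` -/
def W4 (m : ℕ) (δ : ℕ → ℤ) : Multiset ℕ :=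
  (2 * m - 1) ::ₘ
    (Finset.Icc 1 (m - 1)).val.map (fun i => if δ i = -1 then 2 * i - 1 else 2 * m - 2 * i)

/-- the multiset
`W_5(δ) = {2i+2j-2 : i<j, δ_i=δ_j=-1} ∪ {4m-2i-2j : i<j, δ_i=δ_j=1}
          ∪ {2(2m-1)+2i-2j : i<j, δ_i<δ_j} ∪ {2j-2i : i<j, δ_i>δ_j}`,
where `1 ≤ i < j ≤ m-1` -/
def W5 (m : ℕ) (δ : ℕ → ℤ) : Multiset ℕ :=
  ((((Finset.Icc 1 (m - 1)) ×ˢ (Finset.Icc 1 (m - 1))).filter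
      (fun q => q.1 < q.2)).val).map
    (fun q =>
      if δ q.1 = -1 ∧ δ q.2 = -1 then 2 * q.1 + 2 * q.2 - 2
      else if δ q.1 = 1 ∧ δ q.2 = 1 then 4 * m - 2 * q.1 - 2 * q.2
      else if δ q.1 < δ q.2 then 2 * (2 * m - 1) + 2 * q.1 - 2 * q.2
      else 2 * q.2 - 2 * q.1)

/-- the formal variable `z` -/
noncomputable def z : PowerSeries ℚ := PowerSeries.X


namespace Ptn

theorem ext_part {lam mu : Ptn} (h : ∀ i, lam.part i = mu.part i) : lam = mu := by
  cases lam
  cases mu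
  congr
  exact Finsupp.ext h

theorem part_antitone (lam : Ptn) {i j : ℕ} (h : i ≤ j) : lam.part j ≤ lam.part i :=
  lam.antitone' h

theorem exists_part_eq_zero (lam : Ptn) : ∃ M, ∀ i, M ≤ i → lam.part i = 0 := by
  obtain ⟨M, hM⟩ := lam.toFun.support.exists_nat_subset_range
  refine ⟨M, fun i hi => ?_⟩
  by_contra h
  have := hM (Finsupp.mem_support_iff.2 h)
  rw [Finset.mem_range] at this
  omega

theorem size_eq_sum_range (lam : Ptn) {M : ℕ} (hM : ∀ i, M ≤ i → lam.part i = 0) :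
    lam.size = ∑ i ∈ Finset.range M, lam.part i := by
  refine Finsupp.sum_of_support_subset _ (fun i hi => ?_) _ (by simp)
  rw [Finset.mem_range]
  by_contra h
  exact Finsupp.mem_support_iff.1 hi (hM i (by omega))

/-- The partition with prescribed parts. -/
noncomputable def ofParts (f : ℕ → ℕ) (hf : ∀ i, f (i + 1) ≤ f i)
    (h0 : ∃ M, ∀ i, M ≤ i → f i = 0) : Ptn where
  toFun := Finsupp.ofSupportFinite f <| by
    obtain ⟨M, hM⟩ := h0
    refine (Finset.range M).finite_toSet.subset fun i hi => ?_
    rw [Finset.mem_coe, Finset.mem_range]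
    by_contra h
    exact hi (hM i (by omega))
  antitone' := fun _ _ h => antitone_nat_of_succ_le hf h

@[simp]
theorem part_ofParts (f : ℕ → ℕ) (hf : ∀ i, f (i + 1) ≤ f i) (h0 : ∃ M, ∀ i, M ≤ i → f i = 0)
    (i : ℕ) : (ofParts f hf h0).part i = f i := rfl

/-- The empty partition. -/
noncomputable def empty : Ptn := ofParts (fun _ => 0) (fun _ => le_rfl) ⟨0, fun _ _ => rfl⟩

theorem part_le_size (lam : Ptn) (i : ℕ) : lam.part i ≤ lam.size := by
  obtain ⟨M, hM⟩ := lam.exists_part_eq_zero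
  rw [lam.size_eq_sum_range (M := M + i + 1) fun j hj => hM j (by omega)]
  exact Finset.single_le_sum (f := lam.part) (fun _ _ => Nat.zero_le _)
    (Finset.mem_range.2 (by omega))

theorem mul_part_le_size (lam : Ptn) (i : ℕ) : (i + 1) * lam.part i ≤ lam.size := by
  obtain ⟨M, hM⟩ := lam.exists_part_eq_zero
  rw [lam.size_eq_sum_range (M := (i + 1) + M) fun j hj => hM j (by omega),
    Finset.sum_range_add]
  refine le_trans ?_ (Nat.le_add_right _ _)
  have := Finset.card_nsmul_le_sum (Finset.range (i + 1)) lam.part (lam.part i)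
    fun j hj => lam.part_antitone (by rw [Finset.mem_range] at hj; omega)
  simpa using this

theorem finite_size_le (d : ℕ) : {lam : Ptn | lam.size ≤ d}.Finite := by
  let φ : {lam : Ptn | lam.size ≤ d} → (Fin (d + 1) → Fin (d + 1)) := fun lam i =>
    ⟨lam.1.part i, Nat.lt_succ_of_le ((lam.1.part_le_size i).trans lam.2)⟩
  have hφ : Function.Injective φ := by
    intro lam mu h
    refine Subtype.ext (ext_part fun i => ?_)
    by_cases hi : i < d + 1
    · exact congrArg Fin.val (congrFun h ⟨i, hi⟩)
    · have hz : ∀ nu : {lam : Ptn | lam.size ≤ d}, nu.1.part i = 0 := fun nu => by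
        have h1 := nu.1.mul_part_le_size i
        have h2 : nu.1.size ≤ d := nu.2
        by_contra h0
        have := Nat.le_mul_of_pos_right (i + 1) (Nat.pos_of_ne_zero h0)
        omega
      rw [hz, hz]
  exact Set.finite_coe_iff.1 (Finite.of_injective φ hφ)

theorem size_eq_of_le {mu lam : Ptn} (h : ∀ i, mu.part i ≤ lam.part i) (hs : lam.size ≤ mu.size) :
    mu = lam := by
  obtain ⟨M, hM⟩ := lam.exists_part_eq_zero
  have hM' : ∀ i, M ≤ i → mu.part i = 0 := fun i hi => by
    have := h i
    have := hM i hi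
    omega
  rw [lam.size_eq_sum_range hM, mu.size_eq_sum_range hM'] at hs
  refine ext_part fun i => ?_
  by_cases hi : i < M
  · exact (Finset.sum_eq_sum_iff_of_le fun j _ => h j).1
      (le_antisymm (Finset.sum_le_sum fun j _ => h j) hs) i (Finset.mem_range.2 hi)
  · rw [hM i (by omega), hM' i (by omega)]

end Ptn

theorem HStrip.size_le {mu lam : Ptn} (h : HStrip mu lam) : mu.size ≤ lam.size := by
  obtain ⟨M, hM⟩ := lam.exists_part_eq_zero
  have hM' : ∀ i, M ≤ i → mu.part i = 0 := fun i hi => by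
    have := (h i).1
    have := hM i hi
    omega
  rw [lam.size_eq_sum_range hM, mu.size_eq_sum_range hM']
  exact Finset.sum_le_sum fun i _ => (h i).1

theorem HStrip.refl (lam : Ptn) : HStrip lam lam :=
  fun i => ⟨le_rfl, lam.part_antitone (Nat.le_succ i)⟩

namespace Ptn

/-- The parts of the partition `Ptn.up α β n μ`. -/
def upParts (α β μ : Ptn) (n : ℕ) : ℕ → ℕ
  | 0 => max (α.part 0) (β.part 0) + n
  | i + 1 => max (α.part (i + 1)) (β.part (i + 1)) + min (α.part i) (β.part i) - μ.part i

/-- The upward local toggle: given `μ ≺ α`, `μ ≺ β` and `n`, a partition `λ ≻ α, β`. -/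
noncomputable def up (α β : Ptn) (n : ℕ) (μ : {μ : Ptn // HStrip μ α ∧ HStrip μ β}) :
    {lam : Ptn // HStrip α lam ∧ HStrip β lam} := by
  refine ⟨ofParts (upParts α β μ.1 n) ?_ ?_, ?_⟩
  · rintro (_ | i)
    · have := μ.2.1 0
      have := μ.2.2 0
      simp only [upParts]
      omega
    · have := μ.2.1 i
      have := μ.2.2 i
      have := μ.2.1 (i + 1)
      have := μ.2.2 (i + 1)
      simp only [upParts]
      omega
  · obtain ⟨M, hM⟩ := α.exists_part_eq_zero
    obtain ⟨M', hM'⟩ := β.exists_part_eq_zero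
    refine ⟨M + M' + 1, ?_⟩
    rintro (_ | i) hi
    · omega
    · have := hM i (by omega)
      have := hM (i + 1) (by omega)
      have := hM' (i + 1) (by omega)
      simp only [upParts]
      omega
  · refine ⟨fun i => ?_, fun i => ?_⟩ <;>
    · have := μ.2.1 i
      have := μ.2.2 i
      rcases i with _ | i
      · simp only [part_ofParts, upParts]
        omega
      · have := μ.2.1 i
        have := μ.2.2 i
        simp only [part_ofParts, upParts]
        omega

/-- The downward local toggle, inverse to `Ptn.up`. -/
noncomputable def down (α β : Ptn) (lam : {lam : Ptn // HStrip α lam ∧ HStrip β lam}) :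
    {μ : Ptn // HStrip μ α ∧ HStrip μ β} := by
  refine ⟨ofParts (fun i => max (α.part (i + 1)) (β.part (i + 1)) +
    min (α.part i) (β.part i) - lam.1.part (i + 1)) ?_ ?_, ?_⟩
  · intro i
    have := lam.2.1 i
    have := lam.2.2 i
    have := lam.2.1 (i + 1)
    have := lam.2.2 (i + 1)
    have := lam.2.1 (i + 1 + 1)
    have := lam.2.2 (i + 1 + 1)
    omega
  · obtain ⟨M, hM⟩ := α.exists_part_eq_zero
    obtain ⟨M', hM'⟩ := β.exists_part_eq_zero
    refine ⟨M + M', fun i hi => ?_⟩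
    have := hM i (by omega)
    have := hM (i + 1) (by omega)
    have := hM' (i + 1) (by omega)
    omega
  · refine ⟨fun i => ?_, fun i => ?_⟩ <;>
    · have := lam.2.1 i
      have := lam.2.2 i
      have := lam.2.1 (i + 1)
      have := lam.2.2 (i + 1)
      simp only [part_ofParts]
      omega

/-- The local bijection behind the commutation relation of vertex operators. -/
noncomputable def toggle (α β : Ptn) :
    {lam : Ptn // HStrip α lam ∧ HStrip β lam} ≃ ℕ × {μ : Ptn // HStrip μ α ∧ HStrip μ β} where
  toFun lam := (lam.1.part 0 - max (α.part 0) (β.part 0), down α β lam)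
  invFun p := up α β p.1 p.2
  left_inv lam := by
    refine Subtype.ext (ext_part ?_)
    rintro (_ | i)
    · have := lam.2.1 0
      have := lam.2.2 0
      simp only [up, upParts, down, part_ofParts]
      omega
    · have := lam.2.1 i
      have := lam.2.2 i
      have := lam.2.1 (i + 1)
      have := lam.2.2 (i + 1)
      simp only [up, upParts, down, part_ofParts]
      omega
  right_inv := by
    rintro ⟨n, μ⟩
    refine Prod.ext ?_ (Subtype.ext (ext_part fun i => ?_))
    · simp only [up, upParts, part_ofParts]
      omega
    · have := μ.2.1 i
      have := μ.2.2 i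
      simp only [up, upParts, down, part_ofParts]
      omega

theorem size_toggle (α β : Ptn) (lam : {lam : Ptn // HStrip α lam ∧ HStrip β lam}) :
    lam.1.size + (toggle α β lam).2.1.size = (toggle α β lam).1 + α.size + β.size := by
  obtain ⟨A, hA⟩ := α.exists_part_eq_zero
  obtain ⟨B, hB⟩ := β.exists_part_eq_zero
  obtain ⟨C, hC⟩ := lam.1.exists_part_eq_zero
  obtain ⟨D, hD⟩ := (toggle α β lam).2.1.exists_part_eq_zero
  rw [α.size_eq_sum_range (M := A + B + C + D + 1) fun i hi => hA i (by omega),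
    β.size_eq_sum_range (M := A + B + C + D + 1) fun i hi => hB i (by omega),
    lam.1.size_eq_sum_range (M := A + B + C + D + 1) fun i hi => hC i (by omega),
    (toggle α β lam).2.1.size_eq_sum_range (M := A + B + C + D) fun i hi => hD i (by omega),
    add_assoc (toggle α β lam).1, ← Finset.sum_add_distrib]
  have key : ∀ n, ∑ i ∈ Finset.range (n + 1), lam.1.part i +
      ∑ i ∈ Finset.range n, (toggle α β lam).2.1.part i + min (α.part n) (β.part n) =
      (toggle α β lam).1 + ∑ i ∈ Finset.range (n + 1), (α.part i + β.part i) := by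
    intro n
    induction n with
    | zero =>
      have := lam.2.1 0
      have := lam.2.2 0
      simp only [toggle, Equiv.coe_fn_mk, Finset.sum_range_succ, Finset.sum_range_zero]
      omega
    | succ n ih =>
      rw [Finset.sum_range_succ lam.1.part (n + 1),
        Finset.sum_range_succ (toggle α β lam).2.1.part n,
        Finset.sum_range_succ (fun i => α.part i + β.part i) (n + 1)]
      have h1 := lam.2.1 n
      have h2 := lam.2.2 n
      have h3 := lam.2.1 (n + 1)
      have h4 := lam.2.2 (n + 1)
      have h5 : (toggle α β lam).2.1.part n = max (α.part (n + 1)) (β.part (n + 1)) +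
        min (α.part n) (β.part n) - lam.1.part (n + 1) := rfl
      omega
  have := key (A + B + C + D)
  have := hA (A + B + C + D) (by omega)
  omega

/-- The local bijection behind the reflection relation of vertex operators. -/
theorem exists_reflect (α : Ptn) :
    ∃ e : {lam : Ptn // HStrip α lam} ≃ ℕ × {μ : Ptn // HStrip μ α}, ∀ lam,
      lam.1.size + (e lam).2.1.size = (e lam).1 + α.size + α.size := by
  refine ⟨(Equiv.subtypeEquivRight fun lam => (and_self_iff).symm).trans ((toggle α α).trans
    (Equiv.prodCongr (Equiv.refl _) (Equiv.subtypeEquivRight fun lam => and_self_iff))),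
    fun lam => size_toggle α α ⟨lam.1, lam.2, lam.2⟩⟩

end Ptn

/-- The generating function of a type `X` with an integer weight. -/
noncomputable def weightGF {X : Type} (w : X → ℤ) : PowerSeries ℚ :=
  PowerSeries.mk fun d => (Nat.card {x // w x = (d : ℤ)} : ℚ)

/-- A weight that is nonnegative with finite fibres. -/
structure IsAdmissible {X : Type} (w : X → ℤ) : Prop where
  nonneg : ∀ x, 0 ≤ w x
  finite : ∀ d : ℤ, Finite {x // w x = d}

theorem weightGF_congr {X Y : Type} {f : X → ℤ} {g : Y → ℤ} (e : X ≃ Y)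
    (h : ∀ x, f x = g (e x)) : weightGF f = weightGF g := by
  ext d
  simp only [weightGF, PowerSeries.coeff_mk]
  rw [Nat.card_congr (e.subtypeEquiv (p := fun x => f x = d) (q := fun y => g y = d)
    fun x => by rw [h])]

theorem IsAdmissible.congr {X Y : Type} {f : X → ℤ} {g : Y → ℤ} (hf : IsAdmissible f) (e : X ≃ Y)
    (h : ∀ x, f x = g (e x)) : IsAdmissible g := by
  refine ⟨fun y => ?_, fun d => ?_⟩
  · have := h (e.symm y)
    rw [Equiv.apply_symm_apply] at this
    rw [← this]
    exact hf.nonneg _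
  · have := hf.finite d
    exact Finite.of_equiv _ (e.subtypeEquiv (p := fun x => f x = d) (q := fun y => g y = d)
      fun x => by rw [h])

/-- `X` splits as `ℕ × Y`, the `ℕ`-component having weight `t` per unit. -/
def Splits {X Y : Type} (t : ℤ) (f : X → ℤ) (g : Y → ℤ) : Prop :=
  ∃ e : X ≃ ℕ × Y, ∀ x, f x = t * (e x).1 + g (e x).2

namespace Splits

variable {X Y : Type} {t : ℤ} {f : X → ℤ} {g : Y → ℤ}

theorem congr {X' Y' : Type} {f' : X' → ℤ} {g' : Y' → ℤ} (h : Splits t f g) (eX : X' ≃ X)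
    (eY : Y' ≃ Y) (hX : ∀ x, f' x = f (eX x)) (hY : ∀ y, g' y = g (eY y)) : Splits t f' g' := by
  obtain ⟨e, he⟩ := h
  refine ⟨eX.trans (e.trans (Equiv.prodCongr (Equiv.refl _) eY.symm)), fun x => ?_⟩
  simp [hX, hY, he]

theorem sigma {I : Type} {X Y : I → Type} {f : ∀ i, X i → ℤ} {g : ∀ i, Y i → ℤ} (k : I → ℤ)
    (h : ∀ i, Splits t (f i) (g i)) :
    Splits t (fun p : Σ i, X i => f p.1 p.2 + k p.1) (fun p : Σ i, Y i => g p.1 p.2 + k p.1) := by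
  choose e he using h
  refine ⟨⟨fun p => ((e p.1 p.2).1, ⟨p.1, (e p.1 p.2).2⟩),
    fun p => ⟨p.2.1, (e p.2.1).symm (p.1, p.2.2)⟩, fun p => ?_, fun p => ?_⟩, fun p => ?_⟩
  · simp
  · simp
  · simp [he, add_assoc]

theorem pos (h : Splits t f g) (hf : IsAdmissible f) [hX : Nonempty X] : 0 < t := by
  obtain ⟨e, he⟩ := h
  obtain ⟨x⟩ := hX
  have key : ∀ n : ℕ, f (e.symm (n, (e x).2)) = t * n + g (e x).2 := fun n => by
    rw [he, Equiv.apply_symm_apply]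
  by_contra ht
  rcases (not_lt.1 ht).lt_or_eq with ht | ht
  · have h1 := hf.nonneg (e.symm ((g (e x).2).toNat + 1, (e x).2))
    rw [key] at h1
    have h2 := Int.self_le_toNat (g (e x).2)
    push_cast at h1 h2
    nlinarith
  · have := hf.finite (g (e x).2)
    refine not_injective_infinite_finite
      (fun n : ℕ => (⟨e.symm (n, (e x).2), by rw [key, ht]; ring⟩ : {x' // f x' = g (e x).2}))
      fun a b hab => ?_
    simpa using hab

theorem isAdmissible (h : Splits t f g) (hf : IsAdmissible f) : IsAdmissible g := by
  obtain ⟨e, he⟩ := h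
  have key : ∀ y, f (e.symm (0, y)) = g y := fun y => by simp [he]
  refine ⟨fun y => key y ▸ hf.nonneg _, fun d => ?_⟩
  have := hf.finite d
  refine Finite.of_injective
    (fun y : {y // g y = d} => (⟨e.symm (0, y.1), by rw [key, y.2]⟩ : {x // f x = d}))
    fun a b hab => ?_
  simpa [Subtype.ext_iff] using hab

theorem card_eq (h : Splits t f g) (hf : IsAdmissible f) (d : ℤ) :
    Nat.card {x // f x = d} = Nat.card {y // g y = d} + Nat.card {x // f x = d - t} := by
  have := (h.isAdmissible hf).finite d
  have := hf.finite (d - t)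
  obtain ⟨e, he⟩ := h
  rw [← Nat.card_sum]
  refine Nat.card_congr ?_
  have key : ∀ n y, f (e.symm (n, y)) = t * n + g y := fun n y => by simp [he]
  refine Equiv.symm (Equiv.ofBijective
    (Sum.elim (fun y => ⟨e.symm (0, y.1), by
        have h1 := y.2
        rw [key]
        simpa using h1⟩)
      (fun x => ⟨e.symm ((e x.1).1 + 1, (e x.1).2), by
        rw [key]
        have h1 := he x.1
        have h2 := x.2
        push_cast
        linarith⟩)) ⟨?_, ?_⟩)
  · rintro (⟨a, ha⟩ | ⟨a, ha⟩) (⟨b, hb⟩ | ⟨b, hb⟩) hab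
    · simpa using hab
    · simp at hab
    · simp at hab
    · have h1 : (e a).1 = (e b).1 ∧ (e a).2 = (e b).2 := by simpa using hab
      have h2 : a = b := e.injective (Prod.ext h1.1 h1.2)
      subst h2
      rfl
  · rintro ⟨x, hx⟩
    have h1 := he x
    rcases hn : (e x).1 with _ | n
    · refine ⟨Sum.inl ⟨(e x).2, ?_⟩, Subtype.ext ?_⟩
      · rw [hn] at h1
        simp at h1
        rw [← h1, hx]
      · simp [← hn]
    · refine ⟨Sum.inr ⟨e.symm (n, (e x).2), ?_⟩, Subtype.ext ?_⟩
      · rw [key]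
        rw [hn] at h1
        push_cast at h1
        linarith
      · simp [← hn]

theorem weightGF_mul (h : Splits t f g) (hf : IsAdmissible f) [Nonempty X] :
    weightGF f * (1 - PowerSeries.X ^ t.toNat) = weightGF g := by
  have ht := h.pos hf
  ext d
  rw [mul_sub, mul_one, map_sub, PowerSeries.coeff_mul_X_pow']
  simp only [weightGF, PowerSeries.coeff_mk]
  rw [h.card_eq hf]
  push_cast
  split_ifs with hd
  · rw [Nat.cast_sub hd, Int.toNat_of_nonneg ht.le]
    ring
  · have : IsEmpty {x // f x = (d : ℤ) - t} := ⟨fun x => by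
      have := hf.nonneg x.1
      have := x.2
      omega⟩
    rw [@Nat.card_of_isEmpty _ this]
    simp

end Splits

/-- A step of a chain of interlacing partitions: the direction of the step (`true` for `≺`) and
its spectral parameter. -/
abbrev ChainStep := Bool × ℤ

namespace ChainStep

/-- The relation between consecutive partitions prescribed by a step. -/
def Rel (s : ChainStep) (α γ : Ptn) : Prop := if s.1 then HStrip α γ else HStrip γ α

/-- The exponent attached to a step. -/
def coeff (N : ℤ) (s : ChainStep) : ℤ := if s.1 then 2 * N - s.2 else s.2

theorem rel_refl (s : ChainStep) (α : Ptn) : s.Rel α α := by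
  unfold Rel
  split_ifs <;> exact HStrip.refl α

end ChainStep

/-- Chains of interlacing partitions starting at a given partition. -/
def PtnChain : List ChainStep → Ptn → Type
  | [], _ => Unit
  | s :: c, α => Σ γ : {γ // s.Rel α γ}, PtnChain c γ.1

namespace PtnChain

/-- The weight of a chain. -/
def weight (N : ℤ) : (c : List ChainStep) → (α : Ptn) → PtnChain c α → ℤ
  | [], α, _ => N * α.size
  | s :: c, α, r => weight N c r.1.1 r.2 + s.coeff N * (α.size - r.1.1.size)

/-- The weight on all chains with given steps. -/
def totalWeight (N : ℤ) (c : List ChainStep) (p : Σ α, PtnChain c α) : ℤ := weight N c p.1 p.2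

/-- The constant chain. -/
def const : (c : List ChainStep) → (α : Ptn) → PtnChain c α
  | [], _ => ()
  | s :: c, α => ⟨⟨α, s.rel_refl α⟩, const c α⟩

instance (c : List ChainStep) : Nonempty (Σ α, PtnChain c α) := ⟨⟨Ptn.empty, const c _⟩⟩

theorem splits_append {N t : ℤ} {c c' : List ChainStep}
    (h : ∀ α, Splits t (weight N c α) (weight N c' α)) (pre : List ChainStep) (α : Ptn) :
    Splits t (weight N (pre ++ c) α) (weight N (pre ++ c') α) := by
  induction pre generalizing α with
  | nil => exact h α
  | cons s pre ih =>
    exact Splits.sigma (fun γ : {γ // s.Rel α γ} => s.coeff N * (α.size - γ.1.size))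
      fun γ => ih γ.1

theorem splits_total {N t : ℤ} {c c' : List ChainStep}
    (h : ∀ α, Splits t (weight N c α) (weight N c' α)) (pre : List ChainStep) :
    Splits t (totalWeight N (pre ++ c)) (totalWeight N (pre ++ c')) :=
  (Splits.sigma (fun _ => 0) (splits_append h pre)).congr (Equiv.refl _) (Equiv.refl _)
    (fun _ => (add_zero _).symm) fun _ => (add_zero _).symm

/-- A chain with at least two steps, with the second partition singled out. -/
def consConsEquiv (s s' : ChainStep) (c : List ChainStep) (α : Ptn) :
    PtnChain (s :: s' :: c) α ≃
      Σ i : (Σ β, PtnChain c β), {γ // s.Rel α γ ∧ s'.Rel γ i.1} where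
  toFun r := ⟨⟨r.2.1.1, r.2.2⟩, ⟨r.1.1, r.1.2, r.2.1.2⟩⟩
  invFun p := ⟨⟨p.2.1, p.2.2.1⟩, ⟨⟨p.1.1, p.2.2.2⟩, p.1.2⟩⟩
  left_inv _ := rfl
  right_inv _ := rfl

/-- Chains with at least one step, with the first partition singled out. -/
def sigmaConsEquiv (s : ChainStep) (c : List ChainStep) :
    (Σ α, PtnChain (s :: c) α) ≃ Σ i : (Σ β, PtnChain c β), {γ // s.Rel γ i.1} where
  toFun r := ⟨⟨r.2.1.1, r.2.2⟩, ⟨r.1, r.2.1.2⟩⟩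
  invFun p := ⟨p.2.1, ⟨⟨p.1.1, p.2.2⟩, p.1.2⟩⟩
  left_inv _ := rfl
  right_inv _ := rfl

/-- Chains with exactly one step. -/
def singletonEquiv (s : ChainStep) (α : Ptn) : PtnChain [s] α ≃ {γ // s.Rel α γ} where
  toFun r := r.1
  invFun γ := ⟨γ, ()⟩
  left_inv _ := rfl
  right_inv _ := rfl

theorem splits_swap (N x y : ℤ) (c : List ChainStep) (α : Ptn) :
    Splits (x + y - 2 * N) (weight N ((true, x) :: (false, y) :: c) α)
      (weight N ((false, y) :: (true, x) :: c) α) := by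
  have h : ∀ i : (Σ β, PtnChain c β), Splits (x + y - 2 * N)
      (fun γ : {γ // ChainStep.Rel (true, x) α γ ∧ ChainStep.Rel (false, y) γ i.1} =>
        (2 * N - x) * (α.size - γ.1.size) + y * (γ.1.size - i.1.size))
      (fun μ : {μ // ChainStep.Rel (false, y) α μ ∧ ChainStep.Rel (true, x) μ i.1} =>
        y * (α.size - μ.1.size) + (2 * N - x) * (μ.1.size - i.1.size)) := by
    intro i
    refine ⟨Ptn.toggle α i.1, fun γ => ?_⟩
    have h := Ptn.size_toggle α i.1 γ
    zify at h
    linear_combination (x + y - 2 * N) * h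
  have hcomm : ∀ a b c : ℤ, a + b + c = c + b + a := fun _ _ _ => by ring
  exact (Splits.sigma (fun i => weight N c i.1 i.2) h).congr (consConsEquiv _ _ c α)
    (consConsEquiv _ _ c α) (fun _ => hcomm _ _ _) (fun _ => hcomm _ _ _)

theorem splits_reflect_left (N x : ℤ) (c : List ChainStep) :
    Splits x (totalWeight N ((false, x) :: c)) (totalWeight N ((true, x + 2 * N) :: c)) := by
  have h : ∀ i : (Σ β, PtnChain c β), Splits x
      (fun γ : {γ // ChainStep.Rel (false, x) γ i.1} => x * (γ.1.size - i.1.size))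
      (fun μ : {μ // ChainStep.Rel (true, x + 2 * N) μ i.1} =>
        (2 * N - (x + 2 * N)) * (μ.1.size - i.1.size)) := by
    intro i
    obtain ⟨e, he⟩ := Ptn.exists_reflect i.1
    refine ⟨e, fun γ => ?_⟩
    have h := he γ
    zify at h
    linear_combination x * h
  exact (Splits.sigma (fun i => weight N c i.1 i.2) h).congr (sigmaConsEquiv _ c)
    (sigmaConsEquiv _ c) (fun _ => add_comm _ _) (fun _ => add_comm _ _)

theorem splits_reflect_right (N x : ℤ) (α : Ptn) :
    Splits (x - N) (weight N [(true, x)] α) (weight N [(false, x)] α) := by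
  have h : Splits (x - N)
      (fun γ : {γ // ChainStep.Rel (true, x) α γ} =>
        (2 * N - x) * (α.size - γ.1.size) + N * γ.1.size)
      (fun μ : {μ // ChainStep.Rel (false, x) α μ} =>
        x * (α.size - μ.1.size) + N * μ.1.size) := by
    obtain ⟨e, he⟩ := Ptn.exists_reflect α
    refine ⟨e, fun γ => ?_⟩
    have h := he γ
    zify at h
    linear_combination (x - N) * h
  exact h.congr (singletonEquiv _ α) (singletonEquiv _ α) (fun _ => add_comm _ _)
    (fun _ => add_comm _ _)

end PtnChain

/-- Reduction of power series modulo `X ^ D`. -/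
noncomputable abbrev modXPow (D : ℕ) :
    PowerSeries ℚ →+* PowerSeries ℚ ⧸ Ideal.span {(PowerSeries.X ^ D : PowerSeries ℚ)} :=
  Ideal.Quotient.mk _

theorem modXPow_eq_iff {D : ℕ} {A B : PowerSeries ℚ} :
    modXPow D A = modXPow D B ↔ ∀ d < D, PowerSeries.coeff d A = PowerSeries.coeff d B := by
  rw [Ideal.Quotient.eq, Ideal.mem_span_singleton, PowerSeries.X_pow_dvd_iff]
  simp [sub_eq_zero]

theorem modXPow_one_sub_X_pow {D n : ℕ} (h : D ≤ n) :
    modXPow D (1 - PowerSeries.X ^ n) = 1 := by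
  rw [← map_one (modXPow D), modXPow_eq_iff]
  intro d hd
  rw [map_sub, PowerSeries.coeff_X_pow, if_neg (by omega), sub_zero]

/-- The truncated product `∏_{k < D} (1 - X ^ (p k + t))`. -/
noncomputable def truncPoch (p : ℤ) (D : ℕ) (t : ℤ) : PowerSeries ℚ :=
  ∏ k ∈ Finset.range D, (1 - PowerSeries.X ^ (p * k + t).toNat)

theorem modXPow_truncPoch {p t : ℤ} (D : ℕ) (hp : 0 < p) (ht : 0 ≤ t) :
    modXPow D (truncPoch p D t) =
      modXPow D (1 - PowerSeries.X ^ t.toNat) * modXPow D (truncPoch p D (t + p)) := by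
  have h : (1 - PowerSeries.X ^ t.toNat) * truncPoch p D (t + p) =
      truncPoch p D t * (1 - PowerSeries.X ^ (p * D + t).toNat) := by
    unfold truncPoch
    rw [← Finset.prod_range_succ (fun k : ℕ =>
        (1 - PowerSeries.X ^ (p * (k : ℤ) + t).toNat : PowerSeries ℚ)),
      Finset.prod_range_succ' (fun k : ℕ =>
        (1 - PowerSeries.X ^ (p * (k : ℤ) + t).toNat : PowerSeries ℚ)), mul_comm]
    congr 1
    · refine Finset.prod_congr rfl fun k _ => ?_
      congr 3
      push_cast
      ring
    · simp
  rw [← map_mul, h, map_mul, modXPow_one_sub_X_pow, mul_one]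
  have : (D : ℤ) ≤ p * D + t := by nlinarith
  omega

theorem modXPow_truncPoch_eq_one {p t : ℤ} {D : ℕ} (hp : 0 ≤ p) (ht : D ≤ t) :
    modXPow D (truncPoch p D t) = 1 := by
  unfold truncPoch
  rw [map_prod]
  refine Finset.prod_eq_one fun k _ => modXPow_one_sub_X_pow ?_
  have : (D : ℤ) ≤ p * k + t := by nlinarith [mul_nonneg hp (Int.natCast_nonneg k)]
  omega

namespace PtnChain

/-- The truncated product attached to a single step. -/
noncomputable def wallFactor (N : ℤ) (D : ℕ) (s : ChainStep) : PowerSeries ℚ :=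
  truncPoch N D (s.2 - if s.1 then N else 0)

/-- The truncated product attached to a step and the parameter of a later step. -/
noncomputable def pairFactor (N : ℤ) (D : ℕ) (s : ChainStep) (y : ℤ) : PowerSeries ℚ :=
  truncPoch (2 * N) D (s.2 + y - if s.1 then 2 * N else 0)

/-- The truncated product attached to a sequence of steps. -/
noncomputable def factor (N : ℤ) (D : ℕ) : List ChainStep → PowerSeries ℚ
  | [] => 1
  | s :: c => wallFactor N D s * ((c.map Prod.snd).map (pairFactor N D s)).prod * factor N D c

theorem modXPow_factor_append {N : ℤ} {D : ℕ} {A : PowerSeries ℚ} {c c' : List ChainStep}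
    (hp : (c.map Prod.snd).Perm (c'.map Prod.snd))
    (h : modXPow D (factor N D c) = modXPow D A * modXPow D (factor N D c'))
    (pre : List ChainStep) :
    modXPow D (factor N D (pre ++ c)) = modXPow D A * modXPow D (factor N D (pre ++ c')) := by
  induction pre with
  | nil => exact h
  | cons s pre ih =>
    simp only [List.cons_append, factor, map_mul, ih, List.map_append, List.prod_append]
    rw [(hp.map (pairFactor N D s)).prod_eq]
    ring

theorem modXPow_factor_swap {N x y : ℤ} (D : ℕ) (hN : 0 < N) (ht : 0 ≤ x + y - 2 * N)
    (c : List ChainStep) :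
    modXPow D (factor N D ((true, x) :: (false, y) :: c)) =
      modXPow D (1 - PowerSeries.X ^ (x + y - 2 * N).toNat) *
        modXPow D (factor N D ((false, y) :: (true, x) :: c)) := by
  have h := modXPow_truncPoch D (p := 2 * N) (by omega) ht
  rw [sub_add_cancel] at h
  have e : y + x - 0 = x + y := by ring
  simp only [factor, pairFactor, List.map_cons, List.prod_cons, map_mul, if_true, h, e,
    Bool.false_eq_true, if_false]
  ring

theorem modXPow_factor_reflect_left {N x : ℤ} (D : ℕ) (hN : 0 < N) (ht : 0 ≤ x)
    (c : List ChainStep) :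
    modXPow D (factor N D ((false, x) :: c)) = modXPow D (1 - PowerSeries.X ^ x.toNat) *
        modXPow D (factor N D ((true, x + 2 * N) :: c)) := by
  have h := modXPow_truncPoch D hN ht
  have e : x + 2 * N - N = x + N := by ring
  have e' : pairFactor N D (true, x + 2 * N) = pairFactor N D (false, x) := by
    funext y
    simp only [pairFactor, if_true, Bool.false_eq_true, if_false]
    congr 1
    ring
  simp only [factor, wallFactor, e', map_mul, if_true, e, Bool.false_eq_true, if_false, sub_zero, h]
  ring

theorem modXPow_factor_reflect_right {N x : ℤ} (D : ℕ) (hN : 0 < N) (ht : 0 ≤ x - N) :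
    modXPow D (factor N D [(true, x)]) = modXPow D (1 - PowerSeries.X ^ (x - N).toNat) *
        modXPow D (factor N D [(false, x)]) := by
  have h := modXPow_truncPoch D hN ht
  rw [sub_add_cancel] at h
  simp only [factor, wallFactor, List.map_nil, List.prod_nil, mul_one, if_true,
    Bool.false_eq_true, if_false, sub_zero, h]

/-- The product formula for chains with given steps, modulo `X ^ D`, provided that the weight is
admissible. -/
def ProductFormula (N : ℤ) (D : ℕ) (c : List ChainStep) : Prop :=
  IsAdmissible (totalWeight N c) →
    modXPow D (weightGF (totalWeight N c)) * modXPow D (factor N D c) =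
      modXPow D (weightGF fun lam : Ptn => N * lam.size)

theorem ProductFormula.of_splits {N t : ℤ} {D : ℕ} {c c' : List ChainStep}
    (h : Splits t (totalWeight N c) (totalWeight N c'))
    (hf : 0 ≤ t → modXPow D (factor N D c) =
      modXPow D (1 - PowerSeries.X ^ t.toNat) * modXPow D (factor N D c'))
    (hc : ProductFormula N D c') : ProductFormula N D c := by
  intro hadm
  rw [hf (h.pos hadm).le, ← hc (h.isAdmissible hadm), ← h.weightGF_mul hadm, map_mul]
  ring

/-- The sequence of decreasing steps with given parameters. -/
def decSteps (l : List ℤ) : List ChainStep := l.map fun x => (false, x)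

theorem ProductFormula.reflect_through {N x : ℤ} {D : ℕ} (hN : 0 < N) (m : List ℤ)
    (pre : List ChainStep) (h : ProductFormula N D (pre ++ decSteps (m ++ [x]))) :
    ProductFormula N D (pre ++ (true, x) :: decSteps m) := by
  induction m generalizing pre with
  | nil =>
    exact .of_splits (splits_total (splits_reflect_right N x) pre)
      (fun ht => modXPow_factor_append (c := [(true, x)]) (c' := [(false, x)])
        (List.Perm.refl _) (modXPow_factor_reflect_right D hN ht) pre) h
  | cons y m ih =>
    refine .of_splits (splits_total (splits_swap N x y (decSteps m)) pre)
      (fun ht => modXPow_factor_append (c := (true, x) :: (false, y) :: decSteps m)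
        (c' := (false, y) :: (true, x) :: decSteps m) (List.Perm.swap _ _ _)
        (modXPow_factor_swap D hN ht _) pre) ?_
    have := ih (pre ++ [(false, y)]) (by simpa [decSteps] using h)
    simpa using this

theorem productFormula_append_decSteps {N : ℤ} {D : ℕ} (hN : 0 < N)
    (h : ∀ l, ProductFormula N D (decSteps l)) (pre : List ChainStep) (m : List ℤ) :
    ProductFormula N D (pre ++ decSteps m) := by
  induction pre using List.reverseRecOn generalizing m with
  | nil => exact h m
  | append_singleton pre s ih =>
    obtain ⟨_ | _, x⟩ := s
    · simpa [decSteps] using ih (x :: m)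
    · simpa using ProductFormula.reflect_through hN m pre (ih (m ++ [x]))

theorem weight_decSteps_nonneg {N : ℤ} (hN : 0 ≤ N) (l : List ℤ) (hl : ∀ x ∈ l, 0 ≤ x) (α : Ptn)
    (r : PtnChain (decSteps l) α) : 0 ≤ weight N (decSteps l) α r := by
  induction l generalizing α with
  | nil => exact mul_nonneg hN (Int.natCast_nonneg _)
  | cons x l ih =>
    have h1 : HStrip r.1.1 α := r.1.2
    have h2 : (0 : ℤ) ≤ (α.size : ℤ) - r.1.1.size := by
      have := h1.size_le
      omega
    exact add_nonneg (ih (fun y hy => hl y (List.mem_cons_of_mem _ hy)) _ r.2)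
      (mul_nonneg (hl x List.mem_cons_self) h2)

theorem card_totalWeight_decSteps {N : ℤ} {D d : ℕ} (hN : 0 ≤ N) (hd : d < D) (l : List ℤ)
    (hl : ∀ x ∈ l, (D : ℤ) ≤ x) :
    Nat.card {p // totalWeight N (decSteps l) p = d} =
      Nat.card {lam : Ptn // N * lam.size = (d : ℤ)} := by
  induction l with
  | nil =>
    exact Nat.card_congr ((Equiv.sigmaPUnit Ptn).subtypeEquiv fun _ => Iff.rfl)
  | cons x l ih =>
    have hl' : ∀ y ∈ l, (D : ℤ) ≤ y := fun y hy => hl y (List.mem_cons_of_mem _ hy)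
    rw [← ih hl']
    symm
    refine Nat.card_congr (Equiv.ofBijective
      (fun q => ⟨⟨q.1.1, ⟨⟨q.1.1, HStrip.refl _⟩, q.1.2⟩⟩, ?_⟩) ⟨fun a b hab => ?_, ?_⟩)
    · change weight N (decSteps l) q.1.1 q.1.2 + x * ((q.1.1.size : ℤ) - q.1.1.size) = d
      rw [sub_self, mul_zero, add_zero]
      exact q.2
    · have h := congrArg (fun p : {p // totalWeight N (decSteps (x :: l)) p = (d : ℤ)} =>
        (⟨p.1.2.1.1, p.1.2.2⟩ : Σ γ, PtnChain (decSteps l) γ)) hab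
      exact Subtype.ext h
    · rintro ⟨⟨α, ⟨⟨γ, hγ⟩, r⟩⟩, hw⟩
      replace hγ : HStrip γ α := hγ
      have hw' : weight N (decSteps l) γ r + x * ((α.size : ℤ) - γ.size) = d := hw
      have h1 := weight_decSteps_nonneg hN l (fun y hy => by have := hl' y hy; omega) γ r
      have h2 := hl x List.mem_cons_self
      have h3 : α.size ≤ γ.size := by
        by_contra hlt
        have h4 : (1 : ℤ) ≤ (α.size : ℤ) - γ.size := by omega
        nlinarith
      obtain rfl := Ptn.size_eq_of_le (fun i => (hγ i).1) h3
      refine ⟨⟨⟨γ, r⟩, ?_⟩, rfl⟩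
      change weight N (decSteps l) γ r = d
      simpa using hw'

theorem productFormula_decSteps_of_le {N : ℤ} {D : ℕ} (hN : 0 ≤ N) (l : List ℤ)
    (hl : ∀ x ∈ l, (D : ℤ) ≤ x) : ProductFormula N D (decSteps l) := by
  have h1 : modXPow D (factor N D (decSteps l)) = 1 := by
    induction l with
    | nil => exact map_one _
    | cons x l ih =>
      have hl' : ∀ y ∈ l, (D : ℤ) ≤ y := fun y hy => hl y (List.mem_cons_of_mem _ hy)
      have hx := hl x List.mem_cons_self
      have h2 : modXPow D (((decSteps l).map Prod.snd).map (pairFactor N D (false, x))).prod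
          = 1 := by
        rw [map_list_prod]
        refine List.prod_eq_one fun a ha => ?_
        simp only [decSteps, List.map_map, List.mem_map, Function.comp_apply] at ha
        obtain ⟨y, hy, rfl⟩ := ha
        have := hl' y hy
        exact modXPow_truncPoch_eq_one (by omega) (by simp; omega)
      have h3 : modXPow D (wallFactor N D (false, x)) = 1 :=
        modXPow_truncPoch_eq_one hN (by simpa using hx)
      change modXPow D (wallFactor N D (false, x) *
        (((decSteps l).map Prod.snd).map (pairFactor N D (false, x))).prod *
          factor N D (decSteps l)) = 1
      rw [map_mul, map_mul, h2, h3, ih hl', one_mul, one_mul]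
  intro _
  rw [h1, mul_one, modXPow_eq_iff]
  intro d hd
  simp only [weightGF, PowerSeries.coeff_mk]
  rw [card_totalWeight_decSteps hN hd l hl]

theorem productFormula_decSteps {N : ℤ} {D : ℕ} (hN : 0 < N) (k : ℕ) (l : List ℤ)
    (hl : ∀ x ∈ l, (D : ℤ) ≤ x + 2 * N * k) : ProductFormula N D (decSteps l) := by
  induction k generalizing l with
  | zero => exact productFormula_decSteps_of_le hN.le l (by simpa using hl)
  | succ k ih =>
    suffices H : ∀ l r : List ℤ, (∀ x ∈ l, (D : ℤ) ≤ x + 2 * N * (k + 1 : ℕ)) →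
        (∀ x ∈ r, (D : ℤ) ≤ x + 2 * N * k) → ProductFormula N D (decSteps (l ++ r)) by
      simpa using H l [] hl (by simp)
    intro l
    induction l with
    | nil => exact fun r _ hr => ih r hr
    | cons x l ihl =>
      intro r hl hr
      refine .of_splits (splits_reflect_left N x (decSteps (l ++ r)))
        (fun ht => modXPow_factor_reflect_left D hN ht _) ?_
      refine ProductFormula.reflect_through hN (l ++ r) [] ?_
      rw [List.nil_append, List.append_assoc]
      refine ihl _ (fun y hy => hl y (List.mem_cons_of_mem _ hy)) fun y hy => ?_
      rcases List.mem_append.1 hy with hy | hy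
      · exact hr y hy
      · rw [List.mem_singleton.1 hy]
        have := hl x List.mem_cons_self
        push_cast at this
        linarith

theorem productFormula {N : ℤ} (D : ℕ) (hN : 0 < N) (c : List ChainStep) :
    ProductFormula N D c := by
  have h : ∀ l, ProductFormula N D (decSteps l) := by
    intro l
    obtain ⟨B, hB⟩ : ∃ B : ℕ, ∀ x ∈ l, -(B : ℤ) ≤ x := by
      induction l with
      | nil => exact ⟨0, by simp⟩
      | cons x l ih =>
        obtain ⟨B, hB⟩ := ih
        refine ⟨B + x.natAbs, fun y hy => ?_⟩
        rcases List.mem_cons.1 hy with rfl | hy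
        · omega
        · have := hB y hy
          omega
    refine productFormula_decSteps hN (D + B) l fun x hx => ?_
    have := hB x hx
    push_cast
    nlinarith [Int.natCast_nonneg D, Int.natCast_nonneg B]
  simpa [decSteps] using productFormula_append_decSteps hN h c []

end PtnChain

namespace Ptn

/-- Adding `n` columns of height `j + 1` to a partition. -/
noncomputable def addColumns (j n : ℕ) (lam : Ptn) : Ptn :=
  ofParts (fun i => lam.part i + if i ≤ j then n else 0)
    (fun i => by
      have := lam.part_antitone (Nat.le_add_right i 1)
      split_ifs <;> omega)
    (by
      obtain ⟨M, hM⟩ := lam.exists_part_eq_zero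
      refine ⟨M + j + 1, fun i hi => ?_⟩
      rw [hM i (by omega), if_neg (by omega)])

/-- Replacing each of the first `j + 1` parts by the next one; this removes all the columns of
height `j + 1` if there are no shorter columns. -/
noncomputable def removeColumns (j : ℕ) (lam : Ptn) : Ptn :=
  ofParts (fun i => if i ≤ j then lam.part (j + 1) else lam.part i)
    (fun i => by
      have := lam.part_antitone (Nat.le_add_right i 1)
      split_ifs
      · exact le_rfl
      · omega
      · exact lam.part_antitone (by omega)
      · exact this)
    (by
      obtain ⟨M, hM⟩ := lam.exists_part_eq_zero
      refine ⟨M + j + 1, fun i hi => ?_⟩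
      rw [hM i (by omega), if_neg (by omega)])

theorem size_addColumns (j n : ℕ) (lam : Ptn) :
    (addColumns j n lam).size = (j + 1) * n + lam.size := by
  obtain ⟨M, hM⟩ := lam.exists_part_eq_zero
  rw [lam.size_eq_sum_range (M := (j + 1) + M) fun i hi => hM i (by omega),
    (addColumns j n lam).size_eq_sum_range (M := (j + 1) + M) fun i hi => by
      simp only [addColumns, part_ofParts]
      rw [hM i (by omega), if_neg (by omega)]]
  simp only [addColumns, part_ofParts, Finset.sum_add_distrib]
  rw [add_comm, Finset.sum_range_add (fun i => if i ≤ j then n else 0),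
    Finset.sum_congr rfl fun i hi => if_pos (Nat.le_of_lt_succ (Finset.mem_range.1 hi)),
    Finset.sum_congr (s₁ := Finset.range M) rfl fun i _ => if_neg (by omega)]
  simp

/-- Splitting off the columns of height `j + 1`. -/
noncomputable def columnsEquiv (j : ℕ) :
    {lam : Ptn // lam.part j = lam.part 0} ≃
      ℕ × {lam : Ptn // lam.part (j + 1) = lam.part 0} where
  toFun lam := (lam.1.part j - lam.1.part (j + 1), ⟨removeColumns j lam.1, by
    simp [removeColumns]⟩)
  invFun p := ⟨addColumns j p.1 p.2.1, by
    have h1 := p.2.1.part_antitone (Nat.zero_le j)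
    have h2 := p.2.1.part_antitone (Nat.le_add_right j 1)
    have h3 := p.2.2
    simp only [addColumns, part_ofParts, le_rfl, if_true, Nat.zero_le]
    omega⟩
  left_inv lam := by
    refine Subtype.ext (ext_part fun i => ?_)
    have h1 := lam.1.part_antitone (Nat.le_add_right j 1)
    have h2 := lam.2
    simp only [addColumns, removeColumns, part_ofParts]
    split_ifs with hi
    · have h3 := lam.1.part_antitone hi
      have h4 := lam.1.part_antitone (Nat.zero_le i)
      omega
    · omega
  right_inv p := by
    have h1 := p.2.1.part_antitone (Nat.zero_le j)
    have h2 := p.2.1.part_antitone (Nat.le_add_right j 1)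
    have h3 := p.2.2
    refine Prod.ext ?_ (Subtype.ext (ext_part fun i => ?_))
    · simp only [addColumns, part_ofParts, le_rfl, if_true]
      rw [if_neg (by omega)]
      omega
    · simp only [addColumns, removeColumns, part_ofParts]
      split_ifs with hi h5
      · omega
      · have h6 := p.2.1.part_antitone hi
        have h4 := p.2.1.part_antitone (Nat.zero_le i)
        omega
      · omega

theorem splits_columns (N : ℤ) (j : ℕ) :
    Splits (N * (j + 1)) (fun lam : {lam : Ptn // lam.part j = lam.part 0} => N * lam.1.size)
      (fun lam : {lam : Ptn // lam.part (j + 1) = lam.part 0} => N * lam.1.size) := by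
  refine ⟨columnsEquiv j, fun lam => ?_⟩
  obtain ⟨p, rfl⟩ := (columnsEquiv j).symm.surjective lam
  rw [Equiv.apply_symm_apply]
  change N * ((addColumns j p.1 p.2.1).size : ℤ) = _
  rw [size_addColumns]
  push_cast
  ring

theorem isAdmissible_mul_size {N : ℤ} (hN : 0 < N) :
    IsAdmissible fun lam : Ptn => N * lam.size := by
  refine ⟨fun lam => by positivity, fun d => ?_⟩
  refine ((finite_size_le d.toNat).subset (fun lam (hl : N * lam.size = d) => ?_)).to_subtype
  have : (lam.size : ℤ) ≤ N * lam.size := by nlinarith [Int.natCast_nonneg lam.size]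
  change lam.size ≤ d.toNat
  omega

theorem modXPow_weightGF_mul_size {N : ℤ} (hN : 0 < N) (D : ℕ) :
    modXPow D (weightGF fun lam : Ptn => N * lam.size) * modXPow D (truncPoch N D N) = 1 := by
  have key : ∀ j : ℕ,
      IsAdmissible (fun lam : {lam : Ptn // lam.part j = lam.part 0} => N * lam.1.size) ∧
      weightGF (fun lam : Ptn => N * lam.size) * truncPoch N j N =
        weightGF fun lam : {lam : Ptn // lam.part j = lam.part 0} => N * lam.1.size := by
    intro j
    induction j with
    | zero =>
      let e : Ptn ≃ {lam : Ptn // lam.part 0 = lam.part 0} :=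
        (Equiv.subtypeUnivEquiv fun _ => rfl).symm
      refine ⟨(isAdmissible_mul_size hN).congr e fun _ => rfl, ?_⟩
      rw [truncPoch, Finset.prod_range_zero, mul_one]
      exact weightGF_congr e fun _ => rfl
    | succ j ih =>
      have : Nonempty {lam : Ptn // lam.part j = lam.part 0} := ⟨⟨empty, rfl⟩⟩
      refine ⟨(splits_columns N j).isAdmissible ih.1, ?_⟩
      rw [← (splits_columns N j).weightGF_mul ih.1, ← ih.2, mul_assoc]
      congr 1
      unfold truncPoch
      rw [Finset.prod_range_succ, mul_add, mul_one]
  rw [← map_mul, (key D).2, ← map_one (modXPow D), modXPow_eq_iff]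
  intro d hd
  simp only [weightGF, PowerSeries.coeff_mk, PowerSeries.coeff_one]
  have hempty : ∀ lam : Ptn, lam.part D = lam.part 0 → N * lam.size = d → lam = empty := by
    intro lam h1 h2
    have h3 := lam.mul_part_le_size D
    have h4 : (lam.size : ℤ) ≤ N * lam.size := by nlinarith [Int.natCast_nonneg lam.size]
    have h5 : lam.part D = 0 := by
      by_contra h
      have : (D + 1) * 1 ≤ (D + 1) * lam.part D := Nat.mul_le_mul_left _ (by omega)
      omega
    refine ext_part fun i => ?_
    have := lam.part_antitone (Nat.zero_le i)
    simp only [empty, part_ofParts]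
    omega
  have hsize : empty.size = 0 := by
    rw [empty.size_eq_sum_range (M := 0) fun _ _ => rfl, Finset.sum_range_zero]
  split_ifs with h0
  · subst h0
    rw [Nat.cast_eq_one, Nat.card_eq_one_iff_unique]
    refine ⟨⟨fun a b => ?_⟩, ⟨⟨⟨empty, rfl⟩, by simp [hsize]⟩⟩⟩
    refine Subtype.ext (Subtype.ext ?_)
    rw [hempty _ a.1.2 a.2, hempty _ b.1.2 b.2]
  · rw [Nat.cast_eq_zero, Nat.card_eq_zero]
    refine .inl ⟨fun a => h0 ?_⟩
    have h1 := a.2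
    rw [hempty _ a.1.2 a.2, hsize] at h1
    simpa using h1.symm

end Ptn

namespace PtnChain

/-- The partitions in a chain, constant after the end of the chain. -/
def get : (c : List ChainStep) → (α : Ptn) → PtnChain c α → ℕ → Ptn
  | [], α, _, _ => α
  | _ :: _, α, _, 0 => α
  | _ :: c, _, r, i + 1 => get c r.1.1 r.2 i

theorem get_zero (c : List ChainStep) (α : Ptn) (r : PtnChain c α) : get c α r 0 = α := by
  cases c <;> rfl

theorem rel_get (l : List ChainStep) (α : Ptn) (r : PtnChain l α) (i : ℕ) (hi : i < l.length) :
    l[i].Rel (get l α r i) (get l α r (i + 1)) := by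
  induction l generalizing α i with
  | nil => exact absurd hi (Nat.not_lt_zero _)
  | cons s l ih =>
    cases i with
    | zero =>
      change s.Rel α (get l r.1.1 r.2 0)
      rw [get_zero]
      exact r.1.2
    | succ i => exact ih r.1.1 r.2 i (Nat.lt_of_succ_lt_succ hi)

theorem eq_of_get_eq (c : List ChainStep) (α : Ptn) (r r' : PtnChain c α)
    (h : ∀ i ≤ c.length, get c α r i = get c α r' i) : r = r' := by
  induction c generalizing α with
  | nil => rfl
  | cons s c ih =>
    obtain ⟨⟨γ, hγ⟩, r⟩ := r
    obtain ⟨⟨γ', hγ'⟩, r'⟩ := r'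
    have h1 : get c γ r 0 = get c γ' r' 0 := h 1 (Nat.succ_le_succ (Nat.zero_le _))
    rw [get_zero, get_zero] at h1
    subst h1
    rw [ih γ r r' fun i hi => h (i + 1) (Nat.succ_le_succ hi)]

theorem exists_get_eq (l : List ChainStep) (L : ℕ → Ptn)
    (h : ∀ (i : ℕ) (hi : i < l.length), l[i].Rel (L i) (L (i + 1))) :
    ∃ r : PtnChain l (L 0), ∀ i ≤ l.length, get l (L 0) r i = L i := by
  induction l generalizing L with
  | nil => exact ⟨(), fun i hi => by rw [Nat.le_zero.1 hi]; rfl⟩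
  | cons s l ih =>
    obtain ⟨r, hr⟩ := ih (fun i => L (i + 1)) fun i hi => h (i + 1) (Nat.succ_lt_succ hi)
    refine ⟨⟨⟨L 1, h 0 (Nat.succ_pos _)⟩, r⟩, fun i hi => ?_⟩
    cases i with
    | zero => rfl
    | succ i => exact hr i (Nat.le_of_succ_le_succ hi)

end PtnChain

/-- The step at position `i` of the right half of a symmetric cylindric partition. -/
def profileStep (N : ℤ) (δ : ℕ → ℤ) (i : ℕ) : ChainStep :=
  (decide (δ i = 1), if δ i = 1 then 2 * N - (2 * i - 1) else 2 * i - 1)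

theorem profileStep_coeff (N : ℤ) (δ : ℕ → ℤ) (i : ℕ) :
    (profileStep N δ i).coeff N = 2 * i - 1 := by
  by_cases h : δ i = 1 <;> simp [profileStep, ChainStep.coeff, h]

theorem profileStep_rel (N : ℤ) (δ : ℕ → ℤ) (i : ℕ) (α γ : Ptn) :
    (profileStep N δ i).Rel α γ ↔ if δ i = 1 then HStrip α γ else HStrip γ α := by
  by_cases h : δ i = 1 <;> simp [profileStep, ChainStep.Rel, h]

/-- The steps at positions `s + 1, …, s + n`. -/
def profileSteps (N : ℤ) (δ : ℕ → ℤ) (s n : ℕ) : List ChainStep :=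
  (List.range' (s + 1) n).map (profileStep N δ)

@[simp]
theorem length_profileSteps (N : ℤ) (δ : ℕ → ℤ) (s n : ℕ) :
    (profileSteps N δ s n).length = n := by
  simp [profileSteps]

theorem getElem_profileSteps (N : ℤ) (δ : ℕ → ℤ) (s n i : ℕ)
    (hi : i < (profileSteps N δ s n).length) :
    (profileSteps N δ s n)[i] = profileStep N δ (s + 1 + i) := by
  simp [profileSteps]

namespace PtnChain

theorem weight_profileSteps {N : ℤ} (δ : ℕ → ℤ) (s n : ℕ) (hN : N = 2 * (s + n) + 1) (α : Ptn)
    (r : PtnChain (profileSteps N δ s n) α) :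
    weight N (profileSteps N δ s n) α r = (2 * s + 1) * α.size +
      2 * ∑ i ∈ Finset.range n, ((get (profileSteps N δ s n) α r (i + 1)).size : ℤ) := by
  induction n generalizing s α with
  | zero =>
    change N * (α.size : ℤ) = _
    rw [hN]
    simp
  | succ n ih =>
    change PtnChain (profileStep N δ (s + 1) :: profileSteps N δ (s + 1) n) α at r
    obtain ⟨γ, r⟩ := r
    have h := ih (s + 1) (by rw [hN]; push_cast; ring) γ.1 r
    change weight N (profileSteps N δ (s + 1) n) γ.1 r +
      (profileStep N δ (s + 1)).coeff N * (α.size - γ.1.size) = _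
    rw [h, profileStep_coeff, Finset.sum_range_succ']
    change _ = _ + 2 * (∑ i ∈ Finset.range n,
      ((get (profileSteps N δ (s + 1) n) γ.1 r (i + 1)).size : ℤ) +
        ((get (profileSteps N δ (s + 1) n) γ.1 r 0).size : ℤ))
    rw [get_zero]
    push_cast
    ring

variable {h : ℕ} {δ : ℕ → ℤ}

/-- The symmetric sequence of partitions whose right half is a given chain. -/
def unfold (N : ℤ) (h : ℕ) (δ : ℕ → ℤ) (p : Σ α, PtnChain (profileSteps N δ 0 h) α)
    (k : Fin (2 * h + 1)) : Ptn :=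
  get _ p.1 p.2 (k - h + (h - k))

theorem isSCP_unfold (N : ℤ) (hδ : IsProfile h δ)
    (p : Σ α, PtnChain (profileSteps N δ 0 h) α) : IsSCP h δ (unfold N h δ p) := by
  have hrel : ∀ k < h, if δ (k + 1) = 1 then HStrip (get _ p.1 p.2 k) (get _ p.1 p.2 (k + 1))
      else HStrip (get _ p.1 p.2 (k + 1)) (get _ p.1 p.2 k) := by
    intro k hk
    have h1 := rel_get _ p.1 p.2 k (by simpa using hk)
    rwa [getElem_profileSteps, profileStep_rel, show 0 + 1 + k = k + 1 by omega] at h1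
  refine ⟨fun i hi => ?_, fun k => ?_⟩
  · simp only [unfold]
    by_cases hih : i + 1 ≤ h
    · have hd : dblProfile h δ (i + 1) = -δ (h - i) := by
        rw [dblProfile, if_pos hih, Nat.add_sub_add_right]
      have h1 := hrel (h - i - 1) (by omega)
      rw [show h - i - 1 + 1 = h - i by omega] at h1
      rw [show i - h + (h - i) = h - i by omega,
        show i + 1 - h + (h - (i + 1)) = h - i - 1 by omega]
      rcases hδ (h - i) (by omega) (by omega) with h2 | h2
      · rw [if_pos h2] at h1
        rwa [if_neg (by rw [hd, h2]; norm_num)]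
      · rw [if_neg (by rw [h2]; norm_num)] at h1
        rwa [if_pos (by rw [hd, h2]; norm_num)]
    · have hd : dblProfile h δ (i + 1) = δ (i - h + 1) := by
        rw [dblProfile, if_neg hih, show i + 1 - h = i - h + 1 by omega]
      have h1 := hrel (i - h) (by omega)
      rw [show i - h + (h - i) = i - h by omega,
        show i + 1 - h + (h - (i + 1)) = i - h + 1 by omega]
      simpa only [hd] using h1
  · have := k.isLt
    simp only [unfold]
    congr 1
    omega

theorem bijective_unfold (N : ℤ) (hδ : IsProfile h δ) :
    Function.Bijective fun p : Σ α, PtnChain (profileSteps N δ 0 h) α =>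
      (⟨unfold N h δ p, isSCP_unfold N hδ p⟩ : {M : Fin (2 * h + 1) → Ptn // IsSCP h δ M}) := by
  refine ⟨fun p q hpq => ?_, fun ⟨M, hM, hsymm⟩ => ?_⟩
  · have hget : ∀ i ≤ h, get _ p.1 p.2 i = get _ q.1 q.2 i := fun i hi => by
      have h1 := congrFun (congrArg Subtype.val hpq) ⟨h + i, by omega⟩
      simpa [unfold, show h + i - h + (h - (h + i)) = i by omega] using h1
    obtain ⟨α, r⟩ := p
    obtain ⟨β, r'⟩ := q
    have h0 := hget 0 (Nat.zero_le _)
    rw [get_zero, get_zero] at h0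
    simp only at h0
    subst h0
    rw [eq_of_get_eq _ _ r r' fun i hi => hget i (by simpa using hi)]
  · let L : ℕ → Ptn := fun i => if hi : i ≤ h then M ⟨h + i, by omega⟩ else Ptn.empty
    obtain ⟨r, hr⟩ := exists_get_eq (profileSteps N δ 0 h) L fun i hi => by
      rw [getElem_profileSteps, profileStep_rel]
      rw [length_profileSteps] at hi
      have h1 := hM (h + i) (by omega)
      have hd : dblProfile h δ (h + i + 1) = δ (0 + 1 + i) := by
        rw [dblProfile, if_neg (by omega), show h + i + 1 - h = 0 + 1 + i by omega]
      simp only [hd] at h1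
      simp only [L]
      rw [dif_pos hi.le, dif_pos (Nat.succ_le_of_lt hi)]
      exact h1
    refine ⟨⟨L 0, r⟩, Subtype.ext (funext fun k => ?_)⟩
    have hk := k.isLt
    simp only [unfold]
    rw [hr _ (by rw [length_profileSteps]; omega)]
    simp only [L]
    rw [dif_pos (by omega)]
    by_cases hkh : h ≤ k
    · exact congrArg M (Fin.ext (by simp only; omega))
    · rw [hsymm k]
      exact congrArg M (Fin.ext (by simp only; omega))

theorem totalWeight_eq_scpSize (p : Σ α, PtnChain (profileSteps (2 * h + 1) δ 0 h) α) :
    totalWeight (2 * h + 1) _ p = scpSize h (unfold (2 * h + 1) h δ p) := by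
  rw [totalWeight, weight_profileSteps δ 0 h (by simp), scpSize]
  simp only [unfold]
  rw [Fin.sum_univ_eq_sum_range
    (fun i => (get _ p.1 p.2 (h + i + 1 - h + (h - (h + i + 1)))).size) h,
    show h - h + (h - h) = 0 by omega, get_zero]
  push_cast
  simp only [one_mul]
  congr 2
  refine Finset.sum_congr rfl fun i _ => ?_
  rw [show h + i + 1 - h + (h - (h + i + 1)) = i + 1 by omega]

end PtnChain

theorem finite_scpSize_eq (h : ℕ) (δ : ℕ → ℤ) (d : ℕ) :
    Finite {ω : {M : Fin (2 * h + 1) → Ptn // IsSCP h δ M} // scpSize h ω.1 = d} := by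
  have hfin : {M : Fin (2 * h + 1) → Ptn | ∀ k, M k ∈ {lam : Ptn | lam.size ≤ d}}.Finite :=
    Set.Finite.pi' fun _ => Ptn.finite_size_le d
  have : Finite {M : Fin (2 * h + 1) → Ptn | ∀ k, (M k).size ≤ d} := hfin.to_subtype
  refine Finite.of_injective (β := {M : Fin (2 * h + 1) → Ptn | ∀ k, (M k).size ≤ d})
    (fun ω => ⟨ω.1.1, ?_⟩) fun a b hab => ?_
  · have hω := ω.2
    have hright : ∀ (i : ℕ) (hi : h + i < 2 * h + 1), (ω.1.1 ⟨h + i, hi⟩).size ≤ d := by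
      intro i hi
      unfold scpSize at hω
      cases i with
      | zero =>
        simp only [Nat.add_zero]
        omega
      | succ i =>
        have h1 := Finset.single_le_sum
          (f := fun i : Fin h => (ω.1.1 ⟨h + (i : ℕ) + 1, by have := i.isLt; omega⟩).size)
          (fun _ _ => Nat.zero_le _) (Finset.mem_univ (⟨i, by omega⟩ : Fin h))
        simp only at h1
        change (ω.1.1 ⟨h + i + 1, _⟩).size ≤ d
        omega
    intro k
    have hk := k.isLt
    by_cases hkh : h ≤ k
    · have h1 := hright (k - h) (by omega)
      rwa [show (⟨h + (k - h), by omega⟩ : Fin (2 * h + 1)) = k from Fin.ext (by simp only; omega)]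
        at h1
    · have h1 := hright (h - k) (by omega)
      rw [ω.1.2.2 k]
      rwa [show (⟨h + (h - k), by omega⟩ : Fin (2 * h + 1)) = ⟨2 * h - k, by omega⟩
        from Fin.ext (by simp only; omega)] at h1
  · exact Subtype.ext (Subtype.ext (Subtype.mk.inj hab))

theorem isAdmissible_scpSize (h : ℕ) (δ : ℕ → ℤ) :
    IsAdmissible fun ω : {M : Fin (2 * h + 1) → Ptn // IsSCP h δ M} => (scpSize h ω.1 : ℤ) := by
  refine ⟨fun _ => Int.natCast_nonneg _, fun d => ?_⟩
  have := finite_scpSize_eq h δ d.toNat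
  exact Finite.of_injective (fun ω => (⟨ω.1, by have := ω.2; omega⟩ :
    {ω : {M : Fin (2 * h + 1) → Ptn // IsSCP h δ M} // scpSize h ω.1 = d.toNat}))
    fun a b hab => Subtype.ext (Subtype.mk.inj hab)

theorem modXPow_weightGF_scpSize {h : ℕ} {δ : ℕ → ℤ} (hδ : IsProfile h δ) (D : ℕ) :
    modXPow D (weightGF fun ω : {M : Fin (2 * h + 1) → Ptn // IsSCP h δ M} =>
        (scpSize h ω.1 : ℤ)) *
      (modXPow D (PtnChain.factor (2 * h + 1) D (profileSteps (2 * h + 1) δ 0 h)) *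
        modXPow D (truncPoch (2 * h + 1) D (2 * h + 1))) = 1 := by
  have hN : (0 : ℤ) < 2 * h + 1 := by positivity
  let e := Equiv.ofBijective _ (PtnChain.bijective_unfold (h := h) (δ := δ) (2 * h + 1) hδ)
  have hw := weightGF_congr (g := fun ω : {M : Fin (2 * h + 1) → Ptn // IsSCP h δ M} =>
    (scpSize h ω.1 : ℤ)) e PtnChain.totalWeight_eq_scpSize
  have hadm : IsAdmissible (PtnChain.totalWeight (2 * h + 1) (profileSteps (2 * h + 1) δ 0 h)) :=
    (isAdmissible_scpSize h δ).congr e.symm fun ω => by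
      obtain ⟨p, rfl⟩ := e.surjective ω
      rw [Equiv.symm_apply_apply]
      exact (PtnChain.totalWeight_eq_scpSize p).symm
  rw [← hw, ← mul_assoc, PtnChain.productFormula D hN _ hadm, Ptn.modXPow_weightGF_mul_size hN]

theorem truncPoch_natCast (P D T : ℕ) :
    truncPoch P D T = ∏ k ∈ Finset.range D, (1 - PowerSeries.X ^ (P * k + T)) := by
  unfold truncPoch
  refine Finset.prod_congr rfl fun k _ => ?_
  congr 2

/-- The factor of index `k` in the denominator of the product formula, with `z` replaced by the
formal variable. -/
noncomputable def cylindricFactor (m : ℕ) (δ : ℕ → ℤ) (k : ℕ) : PowerSeries ℚ :=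
  ((W4 m δ).map fun t => (1 - PowerSeries.X ^ ((2 * m - 1) * k + t) : PowerSeries ℚ)).prod *
    ((W5 m δ).map fun t => (1 - PowerSeries.X ^ (2 * (2 * m - 1) * k + t) : PowerSeries ℚ)).prod

theorem prod_map_range' (s n : ℕ) (F : ℕ → PowerSeries ℚ) :
    ((List.range' s n).map F).prod = ∏ i ∈ Finset.Ico s (s + n), F i := by
  induction n generalizing s with
  | zero => simp
  | succ n ih =>
    rw [List.range'_succ, List.map_cons, List.prod_cons, ih,
      Finset.prod_eq_prod_Ico_succ_bot (a := s) (by omega), show s + 1 + n = s + (n + 1) by omega]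

theorem factor_profileSteps (N : ℤ) (D : ℕ) (δ : ℕ → ℤ) (s n : ℕ) :
    PtnChain.factor N D (profileSteps N δ s n) =
      (∏ i ∈ Finset.Ico (s + 1) (s + 1 + n), PtnChain.wallFactor N D (profileStep N δ i)) *
        ∏ i ∈ Finset.Ico (s + 1) (s + 1 + n), ∏ j ∈ Finset.Ico (i + 1) (s + 1 + n),
          PtnChain.pairFactor N D (profileStep N δ i) (profileStep N δ j).2 := by
  induction n generalizing s with
  | zero => simp [profileSteps, PtnChain.factor]
  | succ n ih =>
    change PtnChain.wallFactor N D (profileStep N δ (s + 1)) *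
      (((profileSteps N δ (s + 1) n).map Prod.snd).map
        (PtnChain.pairFactor N D (profileStep N δ (s + 1)))).prod *
        PtnChain.factor N D (profileSteps N δ (s + 1) n) = _
    rw [ih, profileSteps, List.map_map, List.map_map, prod_map_range',
      Finset.prod_eq_prod_Ico_succ_bot (a := s + 1) (by omega),
      Finset.prod_eq_prod_Ico_succ_bot (a := s + 1) (by omega),
      show s + 1 + 1 + n = s + 1 + (n + 1) by omega]
    simp only [Function.comp_apply]
    ring

theorem factor_mul_truncPoch_eq_prod {h : ℕ} {δ : ℕ → ℤ} (hδ : IsProfile h δ) (D : ℕ) :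
    PtnChain.factor (2 * h + 1) D (profileSteps (2 * h + 1) δ 0 h) *
        truncPoch (2 * h + 1) D (2 * h + 1) =
      ∏ k ∈ Finset.range D, cylindricFactor (h + 1) δ k := by
  have hIco : Finset.Ico (0 + 1) (0 + 1 + h) = Finset.Icc 1 h := by
    ext i
    simp only [Finset.mem_Ico, Finset.mem_Icc]
    omega
  have hhead : truncPoch (2 * h + 1) D (2 * h + 1) = ∏ k ∈ Finset.range D,
      (1 - PowerSeries.X ^ ((2 * (h + 1) - 1) * k + (2 * (h + 1) - 1))) := by
    rw [← truncPoch_natCast]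
    congr 1
  have hwall : ∀ i ∈ Finset.Icc 1 h,
      PtnChain.wallFactor (2 * h + 1) D (profileStep (2 * h + 1) δ i) =
        ∏ k ∈ Finset.range D, (1 - PowerSeries.X ^ ((2 * (h + 1) - 1) * k +
          if δ i = -1 then 2 * i - 1 else 2 * (h + 1) - 2 * i)) := by
    intro i hi
    rw [Finset.mem_Icc] at hi
    rw [← truncPoch_natCast]
    unfold PtnChain.wallFactor profileStep
    rcases hδ i hi.1 hi.2 with h1 | h1 <;> simp only [h1] <;> norm_num <;> congr 1 <;> omega
  have hpair : ∀ i ∈ Finset.Icc 1 h, ∀ j ∈ (Finset.Icc 1 h).filter (i < ·),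
      PtnChain.pairFactor (2 * h + 1) D (profileStep (2 * h + 1) δ i)
          (profileStep (2 * h + 1) δ j).2 =
        ∏ k ∈ Finset.range D, (1 - PowerSeries.X ^ (2 * (2 * (h + 1) - 1) * k +
          if δ i = -1 ∧ δ j = -1 then 2 * i + 2 * j - 2
          else if δ i = 1 ∧ δ j = 1 then 4 * (h + 1) - 2 * i - 2 * j
          else if δ i < δ j then 2 * (2 * (h + 1) - 1) + 2 * i - 2 * j
          else 2 * j - 2 * i)) := by
    intro i hi j hj
    rw [Finset.mem_filter, Finset.mem_Icc] at hj
    rw [Finset.mem_Icc] at hi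
    rw [← truncPoch_natCast]
    unfold PtnChain.pairFactor profileStep
    rcases hδ i hi.1 hi.2 with h1 | h1 <;> rcases hδ j hj.1.1 hj.1.2 with h2 | h2 <;>
      simp only [h1, h2] <;> norm_num <;> congr 1 <;> omega
  have hfilter : ∀ i ∈ Finset.Icc 1 h,
      Finset.Ico (i + 1) (0 + 1 + h) = (Finset.Icc 1 h).filter (i < ·) := by
    intro i _
    ext j
    simp only [Finset.mem_Ico, Finset.mem_filter, Finset.mem_Icc]
    omega
  have hW5 : (∏ i ∈ Finset.Icc 1 h, ∏ j ∈ Finset.Ico (i + 1) (0 + 1 + h),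
      PtnChain.pairFactor (2 * h + 1) D (profileStep (2 * h + 1) δ i)
        (profileStep (2 * h + 1) δ j).2) = ∏ k ∈ Finset.range D, ((W5 (h + 1) δ).map fun t =>
          (1 - PowerSeries.X ^ (2 * (2 * (h + 1) - 1) * k + t) : PowerSeries ℚ)).prod := by
    have h1 := Finset.prod_congr (rfl : Finset.Icc 1 h = _) fun i hi =>
      (Finset.prod_congr (hfilter i hi) (hpair i hi))
    rw [h1]
    simp only [Finset.prod_filter]
    rw [← Finset.prod_product', ← Finset.prod_filter (fun q : ℕ × ℕ => q.1 < q.2),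
      Finset.prod_comm]
    refine Finset.prod_congr rfl fun k _ => ?_
    rw [W5, Multiset.map_map]
    rfl
  have hW4 : (∏ i ∈ Finset.Icc 1 h,
      PtnChain.wallFactor (2 * h + 1) D (profileStep (2 * h + 1) δ i)) *
        truncPoch (2 * h + 1) D (2 * h + 1) = ∏ k ∈ Finset.range D, ((W4 (h + 1) δ).map fun t =>
          (1 - PowerSeries.X ^ ((2 * (h + 1) - 1) * k + t) : PowerSeries ℚ)).prod := by
    rw [Finset.prod_congr rfl hwall, hhead, Finset.prod_comm, ← Finset.prod_mul_distrib]
    refine Finset.prod_congr rfl fun k _ => ?_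
    rw [W4, Multiset.map_cons, Multiset.prod_cons, Multiset.map_map, mul_comm]
    rfl
  simp only [cylindricFactor, Finset.prod_mul_distrib]
  rw [← hW4, ← hW5, factor_profileSteps, hIco]
  ring

theorem cylindricFactor_exponent_pos {m : ℕ} {δ : ℕ → ℤ} (hm : 2 ≤ m) :
    (∀ t ∈ W4 m δ, 0 < t) ∧ ∀ t ∈ W5 m δ, 0 < t := by
  refine ⟨fun t ht => ?_, fun t ht => ?_⟩
  · rw [W4, Multiset.mem_cons, Multiset.mem_map] at ht
    rcases ht with rfl | ⟨i, hi, rfl⟩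
    · omega
    · rw [Finset.mem_val, Finset.mem_Icc] at hi
      split_ifs <;> omega
  · rw [W5, Multiset.mem_map] at ht
    obtain ⟨q, hq, rfl⟩ := ht
    rw [Finset.mem_val, Finset.mem_filter, Finset.mem_product, Finset.mem_Icc,
      Finset.mem_Icc] at hq
    split_ifs <;> omega

theorem prod_map_inv_mul_prod_map (s : Multiset ℕ) (hs : ∀ t ∈ s, 0 < t) (c : ℕ) :
    (s.map fun t => (1 - PowerSeries.X ^ (c + t) : PowerSeries ℚ)⁻¹).prod *
      (s.map fun t => (1 - PowerSeries.X ^ (c + t) : PowerSeries ℚ)).prod = 1 := by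
  rw [← Multiset.prod_map_mul]
  refine Multiset.prod_eq_one fun a ha => ?_
  obtain ⟨t, ht, rfl⟩ := Multiset.mem_map.1 ha
  refine PowerSeries.inv_mul_cancel _ ?_
  have hct : c + t ≠ 0 := by
    have := hs t ht
    omega
  rw [map_sub, map_one, map_pow, PowerSeries.constantCoeff_X, zero_pow hct, sub_zero]
  exact one_ne_zero

theorem modXPow_prod_map_eq_one (s : Multiset ℕ) {c D : ℕ} (hc : D ≤ c) :
    modXPow D (s.map fun t => (1 - PowerSeries.X ^ (c + t) : PowerSeries ℚ)).prod = 1 := by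
  rw [map_multiset_prod, Multiset.map_map]
  refine Multiset.prod_eq_one fun a ha => ?_
  obtain ⟨t, -, rfl⟩ := Multiset.mem_map.1 ha
  exact modXPow_one_sub_X_pow (by omega)

theorem modXPow_cylindricFactor_eq_one {m D k : ℕ} (hm : 2 ≤ m) (δ : ℕ → ℤ) (hk : D ≤ k) :
    modXPow D (cylindricFactor m δ k) = 1 := by
  have h1 : D ≤ (2 * m - 1) * k := hk.trans (Nat.le_mul_of_pos_left k (by omega))
  have h2 : D ≤ 2 * (2 * m - 1) * k := hk.trans (Nat.le_mul_of_pos_left k (by omega))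
  rw [cylindricFactor, map_mul, modXPow_prod_map_eq_one _ h1, modXPow_prod_map_eq_one _ h2,
    one_mul]

theorem tendsto_of_eventually_coeff_eq {ι : Type*} {l : Filter ι} {f : ι → PowerSeries ℚ}
    {F : PowerSeries ℚ}
    (h : ∀ d, ∀ᶠ i in l, PowerSeries.coeff d (f i) = PowerSeries.coeff d F) :
    Filter.Tendsto f l (nhds F) := by
  refine (tendsto_pi_nhds (f := fun i => (f i : (Unit →₀ ℕ) → ℚ)) (g := F)).2 fun n => ?_
  obtain ⟨d, rfl⟩ : ∃ d, n = Finsupp.single () d := ⟨n (), Finsupp.unique_single n⟩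
  exact tendsto_const_nhds.congr' ((h d).mono fun i hi => hi.symm)

instance : T2Space (PowerSeries ℚ) := inferInstanceAs (T2Space ((Unit →₀ ℕ) → ℚ))

theorem hasSum_pow_weightGF {X : Type} {w : X → ℕ} (hw : ∀ d, Finite {x // w x = d}) :
    HasSum (fun x => (PowerSeries.X : PowerSeries ℚ) ^ w x)
      (weightGF fun x => (w x : ℤ)) := by
  refine tendsto_of_eventually_coeff_eq fun d => ?_
  have hfin : {x | w x = d}.Finite := Set.finite_coe_iff.1 (hw d)
  rw [SummationFilter.unconditional_filter]
  filter_upwards [Filter.eventually_ge_atTop hfin.toFinset] with s hs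
  rw [map_sum]
  simp only [PowerSeries.coeff_X_pow, weightGF, PowerSeries.coeff_mk, Nat.cast_inj]
  rw [Finset.sum_boole, Nat.cast_inj]
  change _ = Nat.card {x | w x = d}
  rw [Nat.card_eq_card_finite_toFinset hfin]
  congr 1
  ext x
  simp only [Finset.mem_filter, Set.Finite.mem_toFinset, Set.mem_ofPred_eq]
  exact ⟨fun h => h.2.symm, fun h => ⟨hs (hfin.mem_toFinset.2 h), h.symm⟩⟩

theorem hasProd_of_modXPow {F : PowerSeries ℚ} {g B : ℕ → PowerSeries ℚ}
    (hg : ∀ k, g k * B k = 1) (hB : ∀ D k, D ≤ k → modXPow D (B k) = 1)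
    (hF : ∀ D, modXPow D F * modXPow D (∏ k ∈ Finset.range D, B k) = 1) : HasProd g F := by
  refine tendsto_of_eventually_coeff_eq fun d => ?_
  rw [SummationFilter.unconditional_filter]
  filter_upwards [Filter.eventually_ge_atTop (Finset.range (d + 1))] with s hs
  refine modXPow_eq_iff.1 ?_ d (Nat.lt_succ_self d)
  have h1 : modXPow (d + 1) (∏ k ∈ s, g k) =
      modXPow (d + 1) (∏ k ∈ Finset.range (d + 1), g k) := by
    rw [← Finset.prod_sdiff hs, map_mul, map_prod, Finset.prod_eq_one, one_mul]
    intro k hk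
    rw [Finset.mem_sdiff, Finset.mem_range] at hk
    have h2 := congrArg (modXPow (d + 1)) (hg k)
    rwa [map_mul, hB (d + 1) k (by omega), mul_one, map_one] at h2
  have h3 : modXPow (d + 1) (∏ k ∈ Finset.range (d + 1), g k) *
      modXPow (d + 1) (∏ k ∈ Finset.range (d + 1), B k) = 1 := by
    rw [← map_mul, ← Finset.prod_mul_distrib, Finset.prod_eq_one fun k _ => hg k, map_one]
  rw [h1]
  exact left_inv_eq_right_inv h3 (by rw [mul_comm]; exact hF (d + 1))

/-- **Theorem 6.3**: the generating function for symmetric cylindric partitions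
with profile `δ = (δ_1, …, δ_{m-1})` is
`Σ_{ω ∈ SCP_δ} z^{|ω|}
  = ∏_{k≥0} (∏_{t ∈ W_4(δ)} (1 - z^{(2m-1)k+t})⁻¹)
            (∏_{t ∈ W_5(δ)} (1 - z^{2(2m-1)k+t})⁻¹)`. -/
theorem gf_symmetric_cylindric_partitions (m : ℕ) (hm : 2 ≤ m) (δ : ℕ → ℤ)
    (hδ : IsProfile (m - 1) δ) :
    ∑' ω : {M : Fin (2 * (m - 1) + 1) → Ptn // IsSCP (m - 1) δ M},
      z ^ scpSize (m - 1) ω.1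
    = ∏' k : ℕ,
        ((W4 m δ).map (fun t => (1 - z ^ ((2 * m - 1) * k + t))⁻¹)).prod *
          ((W5 m δ).map (fun t => (1 - z ^ (2 * (2 * m - 1) * k + t))⁻¹)).prod := by
  obtain ⟨h, rfl⟩ : ∃ h, m = h + 1 := ⟨m - 1, by omega⟩
  have hδ' : IsProfile h δ := hδ
  have hsum := hasSum_pow_weightGF (finite_scpSize_eq h δ)
  have hpos := cylindricFactor_exponent_pos (δ := δ) hm
  refine hsum.tsum_eq.trans (HasProd.tprod_eq ?_).symm
  refine hasProd_of_modXPow (B := cylindricFactor (h + 1) δ) (fun k => ?_)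
    (fun D k hk => modXPow_cylindricFactor_eq_one hm δ hk) fun D => ?_
  · rw [cylindricFactor, mul_mul_mul_comm]
    unfold z
    rw [prod_map_inv_mul_prod_map _ hpos.1, prod_map_inv_mul_prod_map _ hpos.2, one_mul]
  · rw [← factor_mul_truncPoch_eq_prod hδ', map_mul]
    exact modXPow_weightGF_scpSize hδ' D
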